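/- arXiv:2509.16915 — 3 statements merged into one kernel-verified Lean document; each statement's English description precedes it below -/
import Mathlib

section
/- Let J be a finite-dimensional real inner product space with dim J = k, and let φ : J → ℝ^k be a linear isomorphism that preserves inner products (⟨φ(x), φ(y)⟩ = ⟨x, y⟩ for all x, y ∈ J). Let ε ∈ (0,1], δ ∈ (0,1), and let 𝒟 be a type of databases equipped with an adjacency relation. Let f : 𝒟 → J satisfy ‖f(D) − f(D')‖ ≤ Δ₂ for all adjacent D, D' (ℓ₂-sensitivity Δ₂ > 0). Set σ = Δ₂·√(2·ln(1.25/δ))/ε, and let M(D) be the law of f(D) + φ⁻¹(ν), where ν ∼ N(0, σ²·I_k) is a standard multivariate Gaussian in ℝ^k scaled by σ. Then for all adjacent D, D' and all Borel sets S ⊆ J, Pr[M(D) ∈ S] ≤ e^ε · Pr[M(D') ∈ S] + δ. -/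
open MeasureTheory ProbabilityTheory RealInnerProductSpace

/-- One-dimensional Cameron-Martin formula. -/
lemma ggm_gaussianReal_shift (b : ℝ) :
    gaussianReal b 1 = (gaussianReal 0 1).withDensity
      (fun x => ENNReal.ofReal (Real.exp (b * x - b ^ 2 / 2))) := by
  rw [gaussianReal_of_var_ne_zero b one_ne_zero, gaussianReal_of_var_ne_zero 0 one_ne_zero,
    ← withDensity_mul _ (measurable_gaussianPDF 0 1) (by fun_prop)]
  congr 1
  ext x
  simp only [Pi.mul_apply, gaussianPDF]
  rw [← ENNReal.ofReal_mul (gaussianPDFReal_nonneg _ _ _)]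
  congr 1
  simp only [gaussianPDFReal]
  rw [mul_assoc (Real.sqrt _)⁻¹, ← Real.exp_add]
  congr 2
  push_cast
  ring

/-- Cameron-Martin formula for the product Gaussian. -/
lemma ggm_pi_shift {ι : Type*} [Fintype ι] (b : ι → ℝ) :
    (Measure.pi (fun _ : ι => gaussianReal 0 1)).map (fun x => b + x) =
      (Measure.pi (fun _ : ι => gaussianReal 0 1)).withDensity
        (fun x => ∏ i, ENNReal.ofReal (Real.exp (b i * x i - b i ^ 2 / 2))) := by
  have h1 : (Measure.pi (fun _ : ι => gaussianReal 0 1)).map (fun x => b + x) =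
      Measure.pi (fun i => gaussianReal (b i) 1) := by
    have hm : ∀ i, (gaussianReal 0 1).map (fun x => b i + x) = gaussianReal (b i) 1 := by
      intro i
      rw [gaussianReal_map_const_add]; simp
    have : ∀ i : ι, SigmaFinite ((gaussianReal 0 1).map (fun x => b i + x)) := by
      intro i; rw [hm i]; infer_instance
    have h2 := Measure.pi_map_pi (μ := fun _ : ι => gaussianReal 0 1)
      (f := fun i (x : ℝ) => b i + x) (fun i => by fun_prop)
    simp only [hm] at h2
    exact h2
  rw [h1]
  refine Measure.pi_eq (fun s hs => ?_)
  rw [withDensity_apply _ (MeasurableSet.univ_pi hs),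
    ← lintegral_indicator (MeasurableSet.univ_pi hs)]
  have h3 : ∀ x : ι → ℝ, (Set.univ.pi s).indicator
      (fun x => ∏ i, ENNReal.ofReal (Real.exp (b i * x i - b i ^ 2 / 2))) x =
      ∏ i, (s i).indicator (fun y => ENNReal.ofReal (Real.exp (b i * y - b i ^ 2 / 2))) (x i) := by
    intro x
    by_cases hx : x ∈ Set.univ.pi s
    · rw [Set.indicator_of_mem hx]
      refine Finset.prod_congr rfl (fun i _ => ?_)
      rw [Set.indicator_of_mem (hx i (Set.mem_univ i))]
    · rw [Set.indicator_of_notMem hx]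
      simp only [Set.mem_univ_pi, not_forall] at hx
      obtain ⟨i, hi⟩ := hx
      exact (Finset.prod_eq_zero (Finset.mem_univ i) (Set.indicator_of_notMem hi _)).symm
  have hmeas : ∀ i, Measurable
      ((s i).indicator (fun y => ENNReal.ofReal (Real.exp (b i * y - b i ^ 2 / 2)))) :=
    fun i => Measurable.indicator (by fun_prop) (hs i)
  simp only [h3]
  rw [lintegral_prod_eq_prod_lintegral_of_indepFun Finset.univ
    (fun i (x : ι → ℝ) => (s i).indicator
      (fun y => ENNReal.ofReal (Real.exp (b i * y - b i ^ 2 / 2))) (x i))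
    (iIndepFun_pi (μ := fun _ : ι => gaussianReal 0 1) (fun i => (hmeas i).aemeasurable))
    (fun i => (hmeas i).comp (measurable_pi_apply i))]
  refine Finset.prod_congr rfl (fun i _ => ?_)
  rw [ggm_gaussianReal_shift (b i), withDensity_apply _ (hs i), ← lintegral_indicator (hs i)]
  exact (measurePreserving_eval (fun _ : ι => gaussianReal 0 1) i).lintegral_comp (hmeas i)

/-- Cameron-Martin formula for the standard Gaussian on Euclidean space. -/
lemma ggm_std_shift {k : ℕ} (a : EuclideanSpace ℝ (Fin k))
    (A : Set (EuclideanSpace ℝ (Fin k))) (hA : MeasurableSet A) :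
    stdGaussian (EuclideanSpace ℝ (Fin k)) {x | a + x ∈ A} =
      ∫⁻ x in A, ENNReal.ofReal (Real.exp (⟪a, x⟫ - ‖a‖ ^ 2 / 2))
        ∂(stdGaussian (EuclideanSpace ℝ (Fin k))) := by
  have hT : Measurable (WithLp.toLp 2 : (Fin k → ℝ) → EuclideanSpace ℝ (Fin k)) := by fun_prop
  have hA' : MeasurableSet {x | a + x ∈ A} := (measurable_const_add a) hA
  rw [← map_pi_eq_stdGaussian, setLIntegral_map hA (by fun_prop) hT,
    Measure.map_apply hT hA']
  have h := congrArg (fun m => m (WithLp.toLp 2 ⁻¹' A)) (ggm_pi_shift (fun i => a i))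
  simp only at h
  rw [Measure.map_apply (by fun_prop) (hT hA), withDensity_apply _ (hT hA)] at h
  refine Eq.trans ?_ (h.trans ?_)
  · rfl
  · refine lintegral_congr (fun x => ?_)
    rw [← ENNReal.ofReal_prod_of_nonneg (fun _ _ => (Real.exp_pos _).le), ← Real.exp_sum,
      EuclideanSpace.real_norm_sq_eq, Finset.sum_sub_distrib, Finset.sum_div]
    congr 3
    simp [PiLp.inner_apply, mul_comm]

/-- Upper half-line has standard Gaussian measure at most one half. -/
lemma ggm_half : gaussianReal 0 1 (Set.Ioi 0) ≤ ENNReal.ofReal (1 / 2) := by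
  have h1 : gaussianReal 0 1 (Set.Iio 0) = gaussianReal 0 1 (Set.Ioi 0) := by
    have h : (gaussianReal 0 1).map (fun x : ℝ => -x) = gaussianReal 0 1 := by
      rw [gaussianReal_map_neg]; simp
    conv_lhs => rw [← h]
    rw [Measure.map_apply (by fun_prop) measurableSet_Iio]
    congr 1
    ext x; simp
  have h2 : gaussianReal 0 1 (Set.Iio 0) + gaussianReal 0 1 (Set.Ioi 0) ≤ 1 := by
    rw [← measure_union _ measurableSet_Ioi]
    · exact prob_le_one
    · rw [Set.disjoint_left]
      intro x hx hx'
      simp only [Set.mem_Iio, Set.mem_Ioi] at hx hx'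
      linarith
  rw [h1] at h2
  rw [← ENNReal.ofReal_toReal (measure_ne_top (gaussianReal 0 1) (Set.Ioi (0:ℝ)))] at h2 ⊢
  rw [← ENNReal.ofReal_add ENNReal.toReal_nonneg ENNReal.toReal_nonneg,
    ENNReal.ofReal_le_one] at h2
  exact ENNReal.ofReal_le_ofReal (by linarith)

lemma ggm_tail_pos (t : ℝ) (ht : 0 ≤ t) :
    gaussianReal 0 1 (Set.Ioi t) ≤ ENNReal.ofReal (Real.exp (-t ^ 2 / 2) / 2) := by
  have h : gaussianReal 0 1 (Set.Ioi t) = gaussianReal (-t) 1 (Set.Ioi 0) := by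
    have h : (gaussianReal 0 1).map (fun x : ℝ => -t + x) = gaussianReal (-t) 1 := by
      rw [gaussianReal_map_const_add]; simp
    rw [← h, Measure.map_apply (by fun_prop) measurableSet_Ioi]
    congr 1
    ext x; simp
  rw [h, ggm_gaussianReal_shift, withDensity_apply _ measurableSet_Ioi]
  calc ∫⁻ x in Set.Ioi 0, ENNReal.ofReal (Real.exp (-t * x - (-t) ^ 2 / 2)) ∂(gaussianReal 0 1)
      ≤ ∫⁻ x in Set.Ioi 0, ENNReal.ofReal (Real.exp (-t ^ 2 / 2)) ∂(gaussianReal 0 1) := by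
        refine setLIntegral_mono measurable_const (fun x hx => ?_)
        refine ENNReal.ofReal_le_ofReal (Real.exp_le_exp.2 ?_)
        have : 0 < x := hx
        nlinarith [mul_nonneg ht this.le]
    _ = ENNReal.ofReal (Real.exp (-t ^ 2 / 2)) * gaussianReal 0 1 (Set.Ioi 0) := by
        rw [setLIntegral_const]
    _ ≤ ENNReal.ofReal (Real.exp (-t ^ 2 / 2)) * ENNReal.ofReal (1 / 2) := by
        gcongr; exact ggm_half
    _ = _ := by
        rw [← ENNReal.ofReal_mul (Real.exp_pos _).le]; congr 1; ring

lemma ggm_tail_neg (t : ℝ) (ht : t ≤ 0) :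
    gaussianReal 0 1 (Set.Ioi t) ≤ ENNReal.ofReal (1 / 2 + -t) := by
  have h1 : gaussianReal 0 1 (Set.Ioc t 0) ≤ ENNReal.ofReal (-t) := by
    rw [gaussianReal_apply _ one_ne_zero]
    calc ∫⁻ x in Set.Ioc t 0, gaussianPDF 0 1 x ≤ ∫⁻ x in Set.Ioc t 0, 1 := by
          refine setLIntegral_mono measurable_const (fun x _ => ?_)
          rw [gaussianPDF, ENNReal.ofReal_le_one, gaussianPDFReal]
          have hs : 1 ≤ Real.sqrt (2 * Real.pi * (1 : NNReal)) := by
            rw [Real.one_le_sqrt]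
            push_cast
            linarith [Real.pi_gt_three]
          have he : Real.exp (-(x - 0) ^ 2 / (2 * (1 : NNReal))) ≤ 1 := by
            rw [Real.exp_le_one_iff]
            push_cast
            nlinarith [sq_nonneg (x - 0)]
          exact mul_le_one₀ (inv_le_one_of_one_le₀ hs) (Real.exp_pos _).le he
      _ = _ := by simp
  rw [← Set.Ioc_union_Ioi_eq_Ioi ht, ENNReal.ofReal_add (by norm_num) (by linarith), add_comm]
  exact (measure_union_le _ _).trans (add_le_add h1 ggm_half)

/-- The tail bound at the calibrated threshold. -/
lemma ggm_tail (δ c : ℝ) (hδ : 0 < δ) (hδ1 : δ < 1)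
    (hc : c = Real.sqrt (2 * Real.log (1.25 / δ))) :
    0 < c ∧ gaussianReal 0 1 (Set.Ioi (c - 1 / (2 * c))) ≤ ENNReal.ofReal δ := by
  have hlog : 0.2 ≤ Real.log (1.25 / δ) := by
    have h1 : (1.25 : ℝ) ≤ 1.25 / δ := by
      rw [le_div_iff₀ hδ]; nlinarith
    have h2 := Real.one_sub_inv_le_log_of_pos (show (0 : ℝ) < 1.25 by norm_num)
    have h3 := Real.log_le_log (by norm_num) h1
    norm_num at h2 h3 ⊢
    linarith
  have hc2 : c ^ 2 = 2 * Real.log (1.25 / δ) := by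
    rw [hc, Real.sq_sqrt (by linarith)]
  have hcpos : 0 < c := by
    rw [hc]; exact Real.sqrt_pos.2 (by linarith)
  have hexp : δ = 1.25 * Real.exp (-c ^ 2 / 2) := by
    rw [hc2, show -(2 * Real.log (1.25 / δ)) / 2 = -Real.log (1.25 / δ) by ring, Real.exp_neg,
      Real.exp_log (by positivity)]
    field_simp
  refine ⟨hcpos, ?_⟩
  have hmul : c * (1 / (2 * c)) = 1 / 2 := by field_simp
  have hq : 0 < 1 / (2 * c) := by positivity
  rcases le_total 0 (c - 1 / (2 * c)) with h | h
  · refine (ggm_tail_pos _ h).trans (ENNReal.ofReal_le_ofReal ?_)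
    have h1 : -(c - 1 / (2 * c)) ^ 2 / 2 ≤ 1 / 2 + -c ^ 2 / 2 := by
      nlinarith [sq_nonneg (1 / (2 * c))]
    have h2 := Real.exp_le_exp.2 h1
    rw [Real.exp_add] at h2
    have h3 : Real.exp (1 / 2) ≤ 2.5 := by
      have := Real.exp_le_exp.2 (show (1 / 2 : ℝ) ≤ 1 by norm_num)
      have h4 := Real.exp_one_lt_d9
      have h5 : Real.exp (1 / 2) * Real.exp (1 / 2) = Real.exp 1 := by
        rw [← Real.exp_add]; norm_num
      nlinarith [Real.exp_pos (1 / 2)]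
    have h4 := Real.exp_pos (-c ^ 2 / 2)
    have h5 := mul_le_mul_of_nonneg_right h3 h4.le
    linarith
  · refine (ggm_tail_neg _ h).trans (ENNReal.ofReal_le_ofReal ?_)
    have h1 : c ^ 2 ≤ 1 / 2 := by nlinarith
    have h2 := Real.add_one_le_exp (-c ^ 2 / 2)
    have h3 : 0.6 ≤ c := by nlinarith
    have h4 : 1 / (2 * c) ≤ c + 0.2 := by
      rw [div_le_iff₀ (by positivity)]; nlinarith
    linarith

/-- The law of a unit linear functional under the standard Gaussian. -/
lemma ggm_law {k : ℕ} (u : EuclideanSpace ℝ (Fin k)) (hu : ‖u‖ = 1) (t : ℝ) :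
    stdGaussian (EuclideanSpace ℝ (Fin k)) {x | t < ⟪u, x⟫} = gaussianReal 0 1 (Set.Ioi t) := by
  have h := IsGaussian.map_eq_gaussianReal (μ := stdGaussian (EuclideanSpace ℝ (Fin k)))
    (innerSL ℝ u)
  rw [integral_strongDual_stdGaussian, variance_dual_stdGaussian, innerSL_apply_norm, hu] at h
  simp only [one_pow, Real.toNNReal_one] at h
  rw [← h, Measure.map_apply (by fun_prop) measurableSet_Ioi]
  rfl

/-- The core estimate for the standard Gaussian. -/
lemma ggm_core {k : ℕ} (a : EuclideanSpace ℝ (Fin k)) (ε δ c : ℝ) (hε : 0 < ε) (hε1 : ε ≤ 1)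
    (hδ : 0 < δ) (hδ1 : δ < 1) (hc : c = Real.sqrt (2 * Real.log (1.25 / δ)))
    (ha : ‖a‖ * c ≤ ε)
    (A : Set (EuclideanSpace ℝ (Fin k))) (hA : MeasurableSet A) :
    stdGaussian (EuclideanSpace ℝ (Fin k)) {x | a + x ∈ A} ≤
      ENNReal.ofReal (Real.exp ε) * stdGaussian (EuclideanSpace ℝ (Fin k)) A
        + ENNReal.ofReal δ := by
  obtain ⟨hcpos, htail⟩ := ggm_tail δ c hδ hδ1 hc
  rcases eq_or_ne a 0 with rfl | ha0
  · simp only [zero_add, Set.ofPred_mem_eq]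
    refine le_add_right (le_mul_of_one_le_left zero_le ?_)
    rw [ENNReal.one_le_ofReal]
    exact Real.one_le_exp hε.le
  have hr : 0 < ‖a‖ := norm_pos_iff.2 ha0
  set G := stdGaussian (EuclideanSpace ℝ (Fin k)) with hG
  set B : Set (EuclideanSpace ℝ (Fin k)) := {x | ε < ⟪a, x⟫ - ‖a‖ ^ 2 / 2} with hB
  have hBm : MeasurableSet B := measurableSet_lt measurable_const (by fun_prop)
  have hsub : {x | a + x ∈ A} ⊆ {x | a + x ∈ A \ B} ∪ {x | a + x ∈ B} := by
    intro x hx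
    by_cases hxB : a + x ∈ B
    · exact Or.inr hxB
    · exact Or.inl ⟨hx, hxB⟩
  refine (measure_mono hsub).trans ((measure_union_le _ _).trans (add_le_add ?_ ?_))
  · rw [ggm_std_shift a _ (hA.diff hBm)]
    calc ∫⁻ x in A \ B, ENNReal.ofReal (Real.exp (⟪a, x⟫ - ‖a‖ ^ 2 / 2)) ∂G
        ≤ ∫⁻ x in A \ B, ENNReal.ofReal (Real.exp ε) ∂G := by
          refine setLIntegral_mono measurable_const (fun x hx => ?_)
          exact ENNReal.ofReal_le_ofReal (Real.exp_le_exp.2 (not_lt.1 hx.2))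
      _ = ENNReal.ofReal (Real.exp ε) * G (A \ B) := by rw [setLIntegral_const]
      _ ≤ _ := by gcongr; exact Set.sdiff_subset
  · refine le_trans ?_ htail
    rw [← ggm_law (‖a‖⁻¹ • a) (by rw [norm_smul, norm_inv, norm_norm, inv_mul_cancel₀ hr.ne'])]
    refine measure_mono (fun x hx => ?_)
    simp only [hB, Set.mem_ofPred_eq, inner_add_right, real_inner_self_eq_norm_sq] at hx
    simp only [Set.mem_ofPred_eq, real_inner_smul_left]
    rw [inv_mul_eq_div, lt_div_iff₀ hr]
    refine lt_of_le_of_lt ?_ (show ε - ‖a‖ ^ 2 / 2 < ⟪a, x⟫ by linarith)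
    have h1 : ‖a‖ ≤ 1 / c := by rw [le_div_iff₀ hcpos]; linarith
    have h2 : 1 / (2 * c) = (1 / c) / 2 := by field_simp
    rw [h2]
    nlinarith

/-- Generic Gaussian mechanism for a finite-dimensional real inner product
space `J` (the `ℓ₂` case of the Gaussian mechanism for Euclidean Jordan algebras). -/
theorem generic_gaussian_mechanism_inner_product_space
    {J : Type*} [NormedAddCommGroup J] [InnerProductSpace ℝ J] [FiniteDimensional ℝ J]
    [MeasurableSpace J] [BorelSpace J]
    {k : ℕ} (hk : Module.finrank ℝ J = k)
    (φ : J ≃ₗ[ℝ] EuclideanSpace ℝ (Fin k))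
    (hφ : ∀ x y : J, ⟪φ x, φ y⟫ = ⟪x, y⟫)
    {𝒟 : Type*} (adj : 𝒟 → 𝒟 → Prop)
    (f : 𝒟 → J) (Δ₂ : ℝ) (hΔ₂ : 0 < Δ₂)
    (ε δ : ℝ) (hε : 0 < ε) (hε1 : ε ≤ 1) (hδ : 0 < δ) (hδ1 : δ < 1)
    (hsens : ∀ D D', adj D D' → ‖f D - f D'‖ ≤ Δ₂)
    (σ : ℝ) (hσ : σ = Δ₂ * Real.sqrt (2 * Real.log (1.25 / δ)) / ε)
    (ν : Measure (EuclideanSpace ℝ (Fin k)))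
    (hν : ν = Measure.map (⇑(EuclideanSpace.equiv (Fin k) ℝ).symm)
        (Measure.pi fun _ : Fin k => gaussianReal 0 (Real.toNNReal (σ ^ 2))))
    (M : 𝒟 → Measure J)
    (hM : ∀ D, M D = Measure.map (fun w => f D + φ.symm w) ν) :
    ∀ D D', adj D D' → ∀ S : Set J, MeasurableSet S →
      M D S ≤ ENNReal.ofReal (Real.exp ε) * M D' S + ENNReal.ofReal δ := by
  have hc := (ggm_tail δ _ hδ hδ1 rfl).1
  set c := Real.sqrt (2 * Real.log (1.25 / δ)) with hcdef
  have hσ0 : 0 < σ := by rw [hσ]; positivity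
  intro D D' hadj S hS
  have hiso : ∀ x, ‖φ x‖ = ‖x‖ := by
    intro x
    rw [norm_eq_sqrt_real_inner, norm_eq_sqrt_real_inner, hφ]
  have hcont : Continuous φ.symm := φ.symm.toLinearMap.continuous_of_finiteDimensional
  have hνG : ν = (stdGaussian (EuclideanSpace ℝ (Fin k))).map (fun x => σ • x) := by
    have hm : (gaussianReal 0 1).map (fun x : ℝ => σ * x)
        = gaussianReal 0 (Real.toNNReal (σ ^ 2)) := by
      rw [gaussianReal_map_const_mul]
      congr 1
      · simp
      · rw [mul_one]
        ext
        simp [sq_nonneg]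
    have : ∀ _i : Fin k, SigmaFinite ((gaussianReal 0 1).map (fun x : ℝ => σ * x)) := by
      intro i; rw [hm]; infer_instance
    have h2 := Measure.pi_map_pi (μ := fun _ : Fin k => gaussianReal 0 1)
      (f := fun _ (x : ℝ) => σ * x) (fun i => by fun_prop)
    simp only [hm] at h2
    rw [hν, ← h2, ← map_pi_eq_stdGaussian, Measure.map_map (by fun_prop) (by fun_prop),
      Measure.map_map (by fun_prop) (by fun_prop)]
    rfl
  have hMG : ∀ E, M E S = stdGaussian (EuclideanSpace ℝ (Fin k))
      {x | f E + φ.symm (σ • x) ∈ S} := by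
    intro E
    have hm1 : Measurable (fun w => f E + φ.symm w) := (continuous_const.add hcont).measurable
    rw [hM, hνG, Measure.map_map hm1 (by fun_prop), Measure.map_apply (by fun_prop) hS]
    rfl
  have hmA : MeasurableSet {x | f D' + φ.symm (σ • x) ∈ S} :=
    (continuous_const.add (hcont.comp (continuous_const_smul σ))).measurable hS
  have key := ggm_core (σ⁻¹ • φ (f D - f D')) ε δ c hε hε1 hδ hδ1 hcdef (by
    rw [norm_smul, hiso, Real.norm_of_nonneg (inv_pos.2 hσ0).le, mul_assoc, inv_mul_le_iff₀ hσ0]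
    have h1 : σ * ε = Δ₂ * c := by rw [hσ]; field_simp
    rw [h1]
    exact mul_le_mul_of_nonneg_right (hsens D D' hadj) hc.le) _ hmA
  rw [hMG D, hMG D']
  refine le_trans (le_of_eq ?_) key
  congr 1
  ext x
  simp only [Set.mem_ofPred_eq, smul_add, smul_inv_smul₀ hσ0.ne', map_add,
    LinearEquiv.symm_apply_apply]
  rw [← add_assoc, add_sub_cancel]
end

section
/- Let ε ∈ (0,1], δ ∈ (0,1), r ≥ 1, and let Sym_r denote the space of r×r real symmetric matrices with inner product ⟨X,Y⟩ = Tr(XY), so dim Sym_r = k = r(r+1)/2. Let φ : Sym_r → ℝ^k be a linear isomorphism preserving this inner product. Let 𝒟 be a type of databases with an adjacency relation, and let f : 𝒟 → Sym_r satisfy ∑_{i=1}^r |λ_i(f(D) − f(D'))| ≤ Δ₁ for all adjacent D, D' (nuclear-norm sensitivity Δ₁ > 0). Set σ = Δ₁·√(2·ln(1.25/δ))/ε and let M(D) be the law of f(D) + φ⁻¹(ν) with ν ∼ N(0, σ²·I_k). Then for all adjacent D, D' and all Borel sets S ⊆ Sym_r, Pr[M(D) ∈ S] ≤ e^ε ·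 Pr[M(D') ∈ S] + δ. -/
open MeasureTheory ProbabilityTheory RealInnerProductSpace

noncomputable instance matrixMeasurableSpace (r : ℕ) :
    MeasurableSpace (Matrix (Fin r) (Fin r) ℝ) :=
  inferInstanceAs (MeasurableSpace (Fin r → Fin r → ℝ))

/-- The space `Sym_r` of `r × r` real symmetric matrices, as a submodule of the matrix space. -/
def symMatrix (r : ℕ) : Submodule ℝ (Matrix (Fin r) (Fin r) ℝ) where
  carrier := {A | A.IsSymm}
  add_mem' := fun hA hB => hA.add hB
  zero_mem' := Matrix.isSymm_zero
  smul_mem' := fun c _ hA => hA.smul c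


open scoped ENNReal NNReal

lemma aux_lintegral_prod {k : ℕ} (μ : Fin k → Measure ℝ) [∀ i, SigmaFinite (μ i)]
    (p : ℝ → ℝ≥0∞) (hp : Measurable p) :
    ∫⁻ w, ∏ i, p (w i) ∂(Measure.pi μ) = ∏ i, ∫⁻ x, p x ∂(μ i) := by
  induction k with
  | zero => simp
  | succ n ih =>
    have hm : Measurable fun w : Fin n → ℝ => ∏ i, p (w i) :=
      Finset.measurable_prod _ fun i _ => hp.comp (measurable_pi_apply i)
    have h := ((measurePreserving_piFinSuccAbove μ 0).symm).lintegral_comp_emb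
      (MeasurableEquiv.measurableEmbedding _) (fun w => ∏ i, p (w i))
    rw [← h]
    simp only [MeasurableEquiv.piFinSuccAbove_symm_apply, Fin.insertNthEquiv,
      Fin.prod_univ_succ, Fin.insertNth_zero, Equiv.coe_fn_mk, Fin.cons_succ,
      Fin.zero_succAbove, Fin.cons_zero, cast_eq]
    rw [lintegral_prod_mul hp.aemeasurable hm.aemeasurable, ih]

lemma aux_pi_withDensity {k : ℕ} (p : ℝ → ℝ≥0∞) (hp : Measurable p)
    [SigmaFinite ((volume : Measure ℝ).withDensity p)] :
    Measure.pi (fun _ : Fin k => (volume : Measure ℝ).withDensity p)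
      = (volume : Measure (Fin k → ℝ)).withDensity (fun w => ∏ i, p (w i)) := by
  apply Measure.pi_eq
  intro s hs
  rw [withDensity_apply _ (MeasurableSet.univ_pi hs), volume_pi, Measure.restrict_pi_pi,
    aux_lintegral_prod _ _ hp]
  exact Finset.prod_congr rfl fun i _ => (withDensity_apply _ (hs i)).symm

lemma aux_half : gaussianReal 0 1 (Set.Ioi (0:ℝ)) ≤ ENNReal.ofReal (1/2) := by
  have h1 : gaussianReal 0 1 (Set.Iio (0:ℝ)) = gaussianReal 0 1 (Set.Ioi (0:ℝ)) := by
    have h := gaussianReal_map_neg (μ := 0) (v := 1)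
    rw [neg_zero] at h
    conv_lhs => rw [← h]
    rw [Measure.map_apply measurable_neg measurableSet_Iio]
    congr 1
    ext x; simp
  have h2 : gaussianReal 0 1 (Set.Iio (0:ℝ)) + gaussianReal 0 1 (Set.Ioi (0:ℝ)) ≤ 1 := by
    rw [← measure_union _ measurableSet_Ioi]
    · exact prob_le_one
    · rw [Set.disjoint_left]
      intro x hx hx'
      simp at hx hx'
      linarith
  rw [h1, ← two_mul] at h2
  have : ENNReal.ofReal (1/2) = 2⁻¹ := by
    rw [one_div, ENNReal.ofReal_inv_of_pos (by norm_num)]; simp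
  rw [this, ENNReal.le_inv_iff_mul_le, mul_comm]
  exact h2

lemma aux_tail_nonneg (t : ℝ) (ht : 0 ≤ t) :
    gaussianReal 0 1 (Set.Ioi t) ≤ ENNReal.ofReal (Real.exp (-t^2/2) / 2) := by
  have h1 : gaussianReal 0 1 (Set.Ioi t) = gaussianReal (-t) 1 (Set.Ioi (0:ℝ)) := by
    have h := gaussianReal_map_add_const (μ := 0) (v := 1) (-t)
    rw [zero_add] at h
    rw [← h, Measure.map_apply (by fun_prop) measurableSet_Ioi]
    congr 1
    ext x; simp
  have h2 : gaussianReal (-t) 1 (Set.Ioi (0:ℝ)) ≤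
      ENNReal.ofReal (Real.exp (-t^2/2)) * gaussianReal 0 1 (Set.Ioi (0:ℝ)) := by
    rw [gaussianReal_apply _ one_ne_zero, gaussianReal_apply _ one_ne_zero,
      ← lintegral_const_mul _ (measurable_gaussianPDF _ _)]
    apply setLIntegral_mono' measurableSet_Ioi
    intro x hx
    have hx : 0 < x := hx
    rw [gaussianPDF, gaussianPDF, ← ENNReal.ofReal_mul (Real.exp_pos _).le]
    apply ENNReal.ofReal_le_ofReal
    rw [gaussianPDFReal, gaussianPDFReal, mul_left_comm, ← Real.exp_add]
    gcongr
    simp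
    nlinarith
  rw [h1]
  refine h2.trans ?_
  rw [div_eq_mul_one_div (Real.exp _), ENNReal.ofReal_mul (Real.exp_pos _).le]
  gcongr
  exact aux_half

lemma aux_tail_neg (t : ℝ) (ht : t ≤ 0) :
    gaussianReal 0 1 (Set.Ioi t) ≤ ENNReal.ofReal (1 / 2 - t) := by
  have h1 : Set.Ioi t ⊆ Set.Ioi 0 ∪ Set.Ioc t 0 := by
    intro x hx
    rcases lt_or_ge 0 x with h | h
    · exact Or.inl h
    · exact Or.inr ⟨hx, h⟩
  have h2 : gaussianReal 0 1 (Set.Ioc t 0) ≤ ENNReal.ofReal (-t) := by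
    rw [gaussianReal_apply _ one_ne_zero]
    calc ∫⁻ x in Set.Ioc t 0, gaussianPDF 0 1 x ≤ ∫⁻ x in Set.Ioc t 0, 1 := by
          apply setLIntegral_mono' measurableSet_Ioc
          intro x _
          rw [gaussianPDF, ← ENNReal.ofReal_one]
          apply ENNReal.ofReal_le_ofReal
          rw [gaussianPDFReal]
          apply mul_le_one₀
          · apply inv_le_one_of_one_le₀
            rw [Real.one_le_sqrt]
            simp
            nlinarith [Real.pi_gt_three]
          · positivity
          · rw [Real.exp_le_one_iff]
            have := sq_nonneg x
            simp
            linarith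
      _ = ENNReal.ofReal (-t) := by simp
  calc _ ≤ _ := measure_mono h1
    _ ≤ _ := measure_union_le _ _
    _ ≤ ENNReal.ofReal (1/2) + ENNReal.ofReal (-t) := add_le_add aux_half h2
    _ = _ := by rw [← ENNReal.ofReal_add (by norm_num) (by linarith)]; rfl

lemma aux_num (δ c t : ℝ) (hδ : 0 < δ) (hδ1 : δ < 1)
    (hc : c = Real.sqrt (2 * Real.log (1.25 / δ))) (ht : c - 1 / (2 * c) ≤ t) :
    gaussianReal 0 1 (Set.Ioi t) ≤ ENNReal.ofReal δ := by
  have hlog : (0.2:ℝ) < Real.log (1.25/δ) := by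
    have h1 : Real.log 1.25 < Real.log (1.25/δ) := by
      apply Real.log_lt_log (by norm_num)
      rw [lt_div_iff₀ hδ]; linarith
    have h2 := Real.one_sub_inv_le_log_of_pos (x := 1.25) (by norm_num)
    norm_num at h1 h2 ⊢
    linarith
  have hc2 : c^2 = 2 * Real.log (1.25/δ) := by
    rw [hc, Real.sq_sqrt (by linarith)]
  have hc0 : 0 ≤ c := hc ▸ Real.sqrt_nonneg _
  have hc6 : 0.6 < c := by nlinarith
  have hd : δ = 1.25 * Real.exp (-c^2/2) := by
    have : -c^2/2 = - Real.log (1.25/δ) := by linarith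
    rw [this, Real.exp_neg, Real.exp_log (by positivity)]
    field_simp
  refine (measure_mono (Set.Ioi_subset_Ioi ht)).trans ?_
  set u := 1 / (2*c) with hu
  have huc : u * c = 1/2 := by rw [hu]; field_simp
  have hu0 : 0 < u := by positivity
  rcases le_total (1/2) (c^2) with h | h
  · have : 0 ≤ c - u := by nlinarith
    refine (aux_tail_nonneg _ this).trans (ENNReal.ofReal_le_ofReal ?_)
    have h1 : Real.exp (-(c-u)^2/2) ≤ Real.exp (-c^2/2) * Real.exp (1/2) := by
      rw [← Real.exp_add]
      apply Real.exp_le_exp.mpr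
      nlinarith
    have h2 : Real.exp (1/2) ≤ 2 := by
      have h3 : Real.exp (1/2) * Real.exp (1/2) = Real.exp 1 := by
        rw [← Real.exp_add]; norm_num
      have := Real.exp_one_lt_d9
      nlinarith [Real.exp_pos (1/2)]
    rw [hd]
    nlinarith [Real.exp_pos (-c^2/2)]
  · have : c - u ≤ 0 := by nlinarith
    refine (aux_tail_neg _ this).trans (ENNReal.ofReal_le_ofReal ?_)
    have := Real.add_one_le_exp (-c^2/2)
    nlinarith

lemma aux_map {k : ℕ} (s : ℝ≥0) (v : Fin k → ℝ) (q : ℝ≥0) (hq : (q:ℝ) = s * ∑ i, v i ^ 2) :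
    (Measure.pi (fun _ : Fin k => gaussianReal 0 s)).map (fun w => ∑ i, v i * w i)
      = gaussianReal 0 q := by
  have hmeas : Measurable (fun w : Fin k → ℝ => ∑ i, v i * w i) := by fun_prop
  have : IsProbabilityMeasure ((Measure.pi (fun _ : Fin k => gaussianReal 0 s)).map (fun w => ∑ i, v i * w i)) := Measure.isProbabilityMeasure_map hmeas.aemeasurable
  apply Measure.ext_of_charFun
  ext t
  rw [charFun_apply_real, integral_map hmeas.aemeasurable (Measurable.aestronglyMeasurable (by fun_prop)),
    charFun_gaussianReal]
  have h : ∀ w : Fin k → ℝ, Complex.exp (t * ((∑ i, v i * w i : ℝ) : ℂ) * Complex.I)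
     = ∏ i, Complex.exp (((t * v i : ℝ) : ℂ) * (w i) * Complex.I) := by
    intro w
    rw [← Complex.exp_sum]
    push_cast
    rw [Finset.mul_sum, Finset.sum_mul]
    congr 1
    exact Finset.sum_congr rfl fun i _ => by ring
  simp_rw [h]
  rw [integral_fintype_prod_eq_prod (f := fun i (x:ℝ) => Complex.exp (((t * v i : ℝ) : ℂ) * x * Complex.I))]
  simp_rw [← charFun_apply_real, charFun_gaussianReal]
  rw [← Complex.exp_sum]
  congr 1
  have hq' : (q:ℂ) = s * ∑ i, (v i : ℂ)^2 := by exact_mod_cast congrArg (fun x : ℝ => (x:ℂ)) hq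
  rw [hq']
  simp [Finset.mul_sum, Finset.sum_mul, Finset.sum_div]
  exact Finset.sum_congr rfl fun i _ => by ring

lemma aux_shift {k : ℕ} (s : ℝ≥0) (hs : s ≠ 0) (v : Fin k → ℝ) (ε : ℝ) (T : Set (Fin k → ℝ))
    (hT : MeasurableSet T) :
    Measure.pi (fun _ : Fin k => gaussianReal 0 s) {w | w + v ∈ T} ≤
      ENNReal.ofReal (Real.exp ε) * Measure.pi (fun _ : Fin k => gaussianReal 0 s) T
      + Measure.pi (fun _ : Fin k => gaussianReal 0 s)
          {w | s * ε < ∑ i, v i * w i + (∑ i, v i ^ 2) / 2} := by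
  set B := {w : Fin k → ℝ | s * ε < ∑ i, v i * w i + (∑ i, v i ^ 2) / 2} with hB
  have hBm : MeasurableSet B := measurableSet_lt (by fun_prop) (by fun_prop)
  have hTm : MeasurableSet {w | w + v ∈ T} := (measurable_add_const v) hT
  have hsub : {w | w + v ∈ T} ⊆ ({w | w + v ∈ T} ∩ Bᶜ) ∪ B := by
    intro w hw
    by_cases h : w ∈ B
    · exact Or.inr h
    · exact Or.inl ⟨hw, h⟩
  refine (measure_mono hsub).trans ((measure_union_le _ _).trans ?_)
  gcongr
  have hs0 : (0:ℝ) < s := by exact_mod_cast pos_iff_ne_zero.mpr hs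
  rw [gaussianReal_of_var_ne_zero _ hs]
  have : IsProbabilityMeasure ((volume:Measure ℝ).withDensity (gaussianPDF 0 s)) := by
    rw [← gaussianReal_of_var_ne_zero _ hs]; infer_instance
  rw [aux_pi_withDensity _ (measurable_gaussianPDF _ _), withDensity_apply _ (hTm.inter hBm.compl),
    withDensity_apply _ hT]
  have hpm : Measurable fun w : Fin k → ℝ => ∏ i, gaussianPDF 0 s (w i) :=
    Finset.measurable_prod _ fun i _ => (measurable_gaussianPDF _ _).comp (measurable_pi_apply i)
  have hinv : ∫⁻ w in T, ∏ i, gaussianPDF 0 s (w i)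
      = ∫⁻ w in {w | w + v ∈ T}, ∏ i, gaussianPDF 0 s ((w + v) i) := by
    exact ((measurePreserving_add_right (volume : Measure (Fin k → ℝ)) v).setLIntegral_comp_preimage
      hT hpm).symm
  rw [hinv, ← lintegral_const_mul _ (show Measurable fun w : Fin k → ℝ => ∏ i, gaussianPDF 0 s ((w + v) i) from
    hpm.comp (measurable_add_const v))]
  calc _ ≤ ∫⁻ w in {w | w + v ∈ T} ∩ Bᶜ, ENNReal.ofReal (Real.exp ε) * ∏ i, gaussianPDF 0 s ((w + v) i) := by
        apply setLIntegral_mono' (hTm.inter hBm.compl)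
        intro w hw
        have hw : ∑ i, v i * w i + (∑ i, v i ^ 2) / 2 ≤ s * ε := not_lt.mp hw.2
        simp only [gaussianPDF]
        rw [← ENNReal.ofReal_prod_of_nonneg (fun i _ => gaussianPDFReal_nonneg _ _ _),
          ← ENNReal.ofReal_prod_of_nonneg (fun i _ => gaussianPDFReal_nonneg _ _ _),
          ← ENNReal.ofReal_mul (Real.exp_pos _).le]
        apply ENNReal.ofReal_le_ofReal
        simp only [gaussianPDFReal, Finset.prod_mul_distrib, ← Real.exp_sum]
        rw [mul_left_comm, ← Real.exp_add]
        gcongr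
        simp only [sub_zero, Pi.add_apply, ← Finset.sum_div, Finset.sum_neg_distrib]
        have e : ∑ i, (w i + v i)^2 = ∑ i, w i ^ 2 + 2 * ∑ i, v i * w i + ∑ i, v i ^ 2 := by
          rw [Finset.mul_sum, ← Finset.sum_add_distrib, ← Finset.sum_add_distrib]
          exact Finset.sum_congr rfl fun i _ => by ring
        rw [e, ← sub_le_iff_le_add, ← sub_div, div_le_iff₀ (by positivity)]
        nlinarith
    _ ≤ _ := lintegral_mono_set Set.inter_subset_left

lemma aux_main {k : ℕ} (ε δ Δ σ : ℝ) (hε : 0 < ε) (hε1 : ε ≤ 1) (hδ : 0 < δ) (hδ1 : δ < 1)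
    (hΔ : 0 < Δ) (hσ : σ = Δ * Real.sqrt (2 * Real.log (1.25 / δ)) / ε)
    (v : Fin k → ℝ) (hv : ∑ i, v i ^ 2 ≤ Δ ^ 2) (T : Set (Fin k → ℝ)) (hT : MeasurableSet T) :
    Measure.pi (fun _ : Fin k => gaussianReal 0 (Real.toNNReal (σ ^ 2))) {w | w + v ∈ T} ≤
      ENNReal.ofReal (Real.exp ε) *
        Measure.pi (fun _ : Fin k => gaussianReal 0 (Real.toNNReal (σ ^ 2))) T
      + ENNReal.ofReal δ := by
  obtain ⟨c, hc⟩ : ∃ c, c = Real.sqrt (2 * Real.log (1.25 / δ)) := ⟨_, rfl⟩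
  have hc0 : 0 < c := by
    rw [hc]
    apply Real.sqrt_pos.mpr
    have : 0 < Real.log (1.25/δ) := Real.log_pos (by rw [lt_div_iff₀ hδ]; linarith)
    linarith
  rw [← hc] at hσ
  have hσ0 : 0 < σ := by rw [hσ]; positivity
  have hs : ((Real.toNNReal (σ^2) : ℝ≥0) : ℝ) = σ^2 := Real.coe_toNNReal _ (by positivity)
  have hs0 : Real.toNNReal (σ^2) ≠ 0 := by
    simpa using hσ0.ne'
  refine (aux_shift _ hs0 v ε T hT).trans ?_
  gcongr
  set s := Real.toNNReal (σ^2)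
  obtain ⟨a, ha⟩ : ∃ a, a = Real.sqrt (∑ i, v i ^ 2) := ⟨_, rfl⟩
  have ha2 : a ^ 2 = ∑ i, v i ^ 2 := by
    rw [ha, Real.sq_sqrt (Finset.sum_nonneg fun i _ => sq_nonneg _)]
  have ha0 : 0 ≤ a := ha ▸ Real.sqrt_nonneg _
  have haΔ : a ≤ Δ := by nlinarith
  rw [← ha2, hs]
  have hmap := aux_map s v (Real.toNNReal ((σ * a)^2)) (by
    rw [Real.coe_toNNReal _ (by positivity), hs, ← ha2]; ring)
  have hset : {w : Fin k → ℝ | σ^2 * ε < ∑ i, v i * w i + a^2 / 2}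
      = (fun w : Fin k → ℝ => ∑ i, v i * w i) ⁻¹' (Set.Ioi (σ^2 * ε - a^2/2)) := by
    ext w
    simp [sub_lt_iff_lt_add]
  rw [hset, ← Measure.map_apply (by fun_prop) measurableSet_Ioi, hmap]
  have hstd : gaussianReal 0 (Real.toNNReal ((σ * a)^2)) = (gaussianReal 0 1).map (fun x => (σ * a) * x) := by
    rw [gaussianReal_map_const_mul]
    congr 1
    · simp
    · ext; simp [Real.coe_toNNReal _ (sq_nonneg (σ * a))]
  rw [hstd, Measure.map_apply (by fun_prop) measurableSet_Ioi]
  refine le_trans (measure_mono ?_) (aux_num δ c _ hδ hδ1 hc le_rfl)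
  intro x hx
  have hx : σ^2 * ε - a^2/2 < σ * a * x := hx
  have hσε : σ * ε = Δ * c := by rw [hσ]; field_simp
  show c - 1 / (2*c) < x
  set u := 1 / (2*c) with hu
  have huc : u * c = 1/2 := by rw [hu]; field_simp
  have hu0 : 0 < u := by positivity
  -- a ≤ Δ = σ ε / c ≤ 2 u σ
  have h1 : a ≤ 2 * u * σ := by
    have : Δ = 2 * u * (σ * ε) := by rw [hσε]; linear_combination (-2 * Δ) * huc
    have h2 : u * σ * ε ≤ u * σ * 1 := by gcongr
    linarith
  have h3 : c * a ≤ σ * ε := by rw [hσε, mul_comm]; gcongr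
  by_contra hcon
  push Not at hcon
  have h4 : σ * a * x ≤ σ * a * (c - u) := by gcongr
  have h5 : σ * (c * a) ≤ σ * (σ * ε) := by gcongr
  have h6 : a * a ≤ a * (2 * u * σ) := by gcongr
  nlinarith
  
lemma aux_trace {r : ℕ} (A : Matrix (Fin r) (Fin r) ℝ) (h : A.IsHermitian) :
    (A * A).trace ≤ (∑ i, |h.eigenvalues i|)^2 := by
  have e : (A * A).trace = ∑ i, h.eigenvalues i ^ 2 := by
    conv_lhs => rw [h.spectral_theorem]
    rw [← map_mul]
    simp [Matrix.diagonal_mul_diagonal, Unitary.conjStarAlgAut_apply, Matrix.trace_mul_cycle, sq]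
  rw [e]
  calc _ = ∑ i, |h.eigenvalues i| ^ 2 := by simp
    _ ≤ _ := Finset.sum_sq_le_sq_sum_of_nonneg fun i _ => abs_nonneg _

/-- The generic Gaussian mechanism on the space of `r × r` real symmetric
matrices with nuclear-norm (`ℓ₁`, i.e. sum of absolute eigenvalues) sensitivity `Δ₁`
is `(ε, δ)`-differentially private. -/
theorem gaussian_mechanism_symmetric_matrices_nuclear_sensitivity
    {r : ℕ} (hr : 1 ≤ r) {k : ℕ} (hk : k = r * (r + 1) / 2)
    (ε δ : ℝ) (hε : 0 < ε) (hε1 : ε ≤ 1) (hδ : 0 < δ) (hδ1 : δ < 1)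
    (φ : symMatrix r ≃ₗ[ℝ] EuclideanSpace ℝ (Fin k))
    (hφ : ∀ X Y : symMatrix r,
      ⟪φ X, φ Y⟫ = ((X : Matrix (Fin r) (Fin r) ℝ) * (Y : Matrix (Fin r) (Fin r) ℝ)).trace)
    {𝒟 : Type*} (adj : 𝒟 → 𝒟 → Prop)
    (f : 𝒟 → symMatrix r) (Δ₁ : ℝ) (hΔ₁ : 0 < Δ₁)
    (hsens : ∀ D D', adj D D' →
      ∀ h : ((f D : Matrix (Fin r) (Fin r) ℝ) - (f D' : Matrix (Fin r) (Fin r) ℝ)).IsHermitian,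
        ∑ i, |h.eigenvalues i| ≤ Δ₁)
    (σ : ℝ) (hσ : σ = Δ₁ * Real.sqrt (2 * Real.log (1.25 / δ)) / ε)
    (ν : Measure (EuclideanSpace ℝ (Fin k)))
    (hν : ν = Measure.map (⇑(EuclideanSpace.equiv (Fin k) ℝ).symm)
        (Measure.pi fun _ : Fin k => gaussianReal 0 (Real.toNNReal (σ ^ 2))))
    (M : 𝒟 → Measure (symMatrix r))
    (hM : ∀ D, M D = Measure.map (fun w => f D + φ.symm w) ν) :
    ∀ D D', adj D D' → ∀ S : Set (symMatrix r), MeasurableSet S →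
      M D S ≤ ENNReal.ofReal (Real.exp ε) * M D' S + ENNReal.ofReal δ := by
  intro D D' hadj S hS
  have hmeas : ∀ D, Measurable (fun w => f D + φ.symm w) := by
    intro D
    apply Measurable.subtype_mk (f := fun w => ((f D + φ.symm w : symMatrix r) :
      Matrix (Fin r) (Fin r) ℝ))
    refine measurable_pi_lambda _ fun i => measurable_pi_lambda _ fun j => ?_
    let L : EuclideanSpace ℝ (Fin k) →ₗ[ℝ] ℝ :=
      { toFun := fun w => (φ.symm w : Matrix (Fin r) (Fin r) ℝ) i j
        map_add' := fun x y => by simp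
        map_smul' := fun c x => by simp }
    have hL : Measurable L := (LinearMap.continuous_of_finiteDimensional L).measurable
    exact hL.const_add ((f D : Matrix (Fin r) (Fin r) ℝ) i j)
  have hE : Measurable (⇑(EuclideanSpace.equiv (Fin k) ℝ).symm) :=
    (EuclideanSpace.equiv (Fin k) ℝ).symm.continuous.measurable
  have hMS : ∀ D, M D S = Measure.pi (fun _ : Fin k => gaussianReal 0 (Real.toNNReal (σ ^ 2)))
      {w | f D + φ.symm ((EuclideanSpace.equiv (Fin k) ℝ).symm w) ∈ S} := by
    intro D
    rw [hM, hν, Measure.map_map (hmeas D) hE, Measure.map_apply ((hmeas D).comp hE) hS]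
    rfl
  have hherm : ((f D : Matrix (Fin r) (Fin r) ℝ) - (f D' : Matrix (Fin r) (Fin r) ℝ)).IsHermitian := by
    have h : ((f D - f D' : symMatrix r) : Matrix (Fin r) (Fin r) ℝ).IsSymm := (f D - f D').2
    rw [Submodule.coe_sub] at h
    rw [Matrix.IsHermitian, Matrix.conjTranspose_eq_transpose_of_trivial]
    exact h
  have hv : ∑ i, (φ (f D - f D')) i ^ 2 ≤ Δ₁ ^ 2 := by
    have h1 : ∑ i, (φ (f D - f D')) i ^ 2 = ⟪φ (f D - f D'), φ (f D - f D')⟫ := by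
      rw [real_inner_self_eq_norm_sq, EuclideanSpace.real_norm_sq_eq]
    rw [h1, hφ, Submodule.coe_sub]
    refine (aux_trace _ hherm).trans ?_
    have h2 := hsens D D' hadj hherm
    have h3 : 0 ≤ ∑ i, |hherm.eigenvalues i| := Finset.sum_nonneg fun i _ => abs_nonneg _
    gcongr
  have key := aux_main ε δ Δ₁ σ hε hε1 hδ hδ1 hΔ₁ hσ (fun i => (φ (f D - f D')) i) hv
    {w | f D' + φ.symm ((EuclideanSpace.equiv (Fin k) ℝ).symm w) ∈ S} (((hmeas D').comp hE) hS)
  rw [hMS D, hMS D']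
  convert key using 3
  ext w
  have hw : f D + φ.symm ((EuclideanSpace.equiv (Fin k) ℝ).symm w)
      = f D' + φ.symm ((EuclideanSpace.equiv (Fin k) ℝ).symm
          (w + fun i => (φ (f D - f D')) i)) := by
    rw [map_add, map_add]
    have h4 : (EuclideanSpace.equiv (Fin k) ℝ).symm (fun i => (φ (f D - f D')) i)
        = φ (f D - f D') := by
      ext i; simp
    rw [h4, LinearEquiv.symm_apply_apply]
    abel
  simp only [Set.mem_setOf_eq, hw]
end

section
/- Let ε ∈ (0,1], δ ∈ (0,1), k ≥ 1, and let 𝒟 be a type of databases equipped with an adjacency relation. Let f : 𝒟 → ℝ^k satisfy ‖f(D) − f(D')‖₂ ≤ Δ₂ for all adjacent D, D' (ℓ₂-sensitivity Δ₂ > 0). Set σ = Δ₂·√(2·ln(1.25/δ))/ε and let M(D) be the law of f(D) + ν where ν ∼ N(0, σ²·I_k). Then for all adjacent D, D' and all Borel sets S ⊆ ℝ^k, Pr[M(D) ∈ S] ≤ e^ε · Pr[M(D') ∈ S] + δ. -/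
open MeasureTheory ProbabilityTheory

lemma gm_half : gaussianReal 0 1 (Set.Ioi 0) ≤ ENNReal.ofReal (1/2) := by
  have h1 : gaussianReal 0 1 (Set.Ioi 0) = gaussianReal 0 1 (Set.Iio 0) := by
    have h := gaussianReal_map_neg (μ := 0) (v := 1)
    rw [neg_zero] at h
    conv_lhs => rw [← h]
    rw [Measure.map_apply (by fun_prop) measurableSet_Ioi]
    congr 1
    ext x; simp
  have h2 : gaussianReal 0 1 (Set.Ioi 0) + gaussianReal 0 1 (Set.Iio 0) ≤ 1 := by
    rw [← measure_union _ measurableSet_Iio]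
    · exact prob_le_one
    · rw [Set.disjoint_left]; intro x hx hx'; simp at hx hx'; linarith
  rw [← h1, ← two_mul] at h2
  rw [ENNReal.ofReal_div_of_pos (by norm_num)]
  rw [ENNReal.le_div_iff_mul_le (by simp) (by simp), mul_comm]
  simpa using h2

lemma gm_tail {x : ℝ} (hx : 0 ≤ x) :
    gaussianReal 0 1 (Set.Ioi x) ≤ ENNReal.ofReal (Real.exp (-x^2/2) * (1/2)) := by
  have h0 : gaussianReal 0 1 (Set.Ioi x) = gaussianReal (-x) 1 (Set.Ioi 0) := by
    have h := gaussianReal_map_add_const (μ := 0) (v := 1) (-x)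
    rw [zero_add] at h
    rw [← h, Measure.map_apply (by fun_prop) measurableSet_Ioi]
    congr 1
    ext y; simp
  rw [h0, gaussianReal_apply _ one_ne_zero, ENNReal.ofReal_mul (Real.exp_pos _).le]
  refine le_trans ?_ (mul_le_mul_right gm_half _)
  rw [gaussianReal_apply _ one_ne_zero, ← lintegral_const_mul _ (measurable_gaussianPDF _ _)]
  refine setLIntegral_mono (by fun_prop) ?_
  intro u hu
  simp only [Set.mem_Ioi] at hu
  rw [gaussianPDF, gaussianPDF, ← ENNReal.ofReal_mul (Real.exp_pos _).le]
  apply ENNReal.ofReal_le_ofReal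
  simp only [gaussianPDFReal]
  rw [mul_left_comm, ← Real.exp_add]
  gcongr
  simp only [NNReal.coe_one, mul_one, sub_zero]
  nlinarith [mul_nonneg hx hu.le]

lemma gm_neg {x : ℝ} (hx : x ≤ 0) :
    gaussianReal 0 1 (Set.Ioi x) ≤ ENNReal.ofReal (-x + 1/2) := by
  rw [← Set.Ioc_union_Ioi_eq_Ioi hx, ENNReal.ofReal_add (by linarith) (by norm_num)]
  refine (measure_union_le _ _).trans (add_le_add ?_ gm_half)
  rw [gaussianReal_apply _ one_ne_zero]
  calc ∫⁻ y in Set.Ioc x 0, gaussianPDF 0 1 y ≤ ∫⁻ y in Set.Ioc x 0, 1 := by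
        refine setLIntegral_mono (by fun_prop) ?_
        intro u hu
        rw [gaussianPDF, ENNReal.ofReal_le_one, gaussianPDFReal]
        apply mul_le_one₀
        · apply inv_le_one_of_one_le₀
          rw [Real.one_le_sqrt]
          simp; nlinarith [Real.pi_gt_three]
        · positivity
        · rw [Real.exp_le_one_iff]
          apply div_nonpos_of_nonpos_of_nonneg
          · nlinarith [sq_nonneg (u-0)]
          · simp
    _ = _ := by simp

lemma gm_num {ε δ x : ℝ} (hε : 0 < ε) (hε1 : ε ≤ 1) (hδ : 0 < δ) (hδ1 : δ < 1) {c : ℝ}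
    (hc : c = Real.sqrt (2 * Real.log (1.25 / δ))) (hx : c - ε / (2 * c) ≤ x) :
    gaussianReal 0 1 (Set.Ioi x) ≤ ENNReal.ofReal δ := by
  have hlog : (0.2:ℝ) ≤ Real.log (1.25 / δ) := by
    have h1 : Real.log 1.25 ≤ Real.log (1.25/δ) := by
      apply Real.log_le_log (by norm_num)
      rw [le_div_iff₀ hδ]; nlinarith
    have h2 := Real.one_sub_inv_le_log_of_pos (show (0:ℝ) < 1.25 by norm_num)
    norm_num at h2 h1 ⊢
    linarith
  have hc2 : c^2 = 2 * Real.log (1.25 / δ) := by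
    rw [hc, Real.sq_sqrt (by linarith)]
  have hδe : δ = 1.25 * Real.exp (-(c^2/2)) := by
    rw [hc2, mul_div_cancel_left₀ _ two_ne_zero, Real.exp_neg, Real.exp_log (by positivity)]
    field_simp
  have hc0 : 0.63 ≤ c := by
    rw [hc]; apply Real.le_sqrt_of_sq_le; norm_num at hlog ⊢; linarith
  have hcp : 0 < c := by linarith
  refine (measure_mono (Set.Ioi_subset_Ioi hx)).trans ?_
  have hdiv : ε / (2*c) * c = ε / 2 := by field_simp
  set y := ε / (2*c) with hy
  have hy0 : 0 < y := by positivity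
  rcases le_total 0 (c - y) with h | h
  · refine (gm_tail h).trans (ENNReal.ofReal_le_ofReal ?_)
    have h3 : Real.exp (-(c-y)^2/2) ≤ Real.exp (-(c^2/2)) * Real.exp 1 := by
      rw [← Real.exp_add]
      apply Real.exp_le_exp.2
      nlinarith
    have h3 : Real.exp (-(c-y)^2/2) ≤ Real.exp (-(c^2/2)) * 2.5 := by
      refine le_trans ?_ (mul_le_mul_of_nonneg_left (?_ : Real.exp (1/2) ≤ 2.5) (Real.exp_pos _).le)
      · rw [← Real.exp_add]
        apply Real.exp_le_exp.2
        nlinarith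
      · have := Real.exp_one_lt_d9
        have h4 : Real.exp (1/2) * Real.exp (1/2) = Real.exp 1 := by
          rw [← Real.exp_add]; norm_num
        nlinarith [Real.exp_pos (1/2)]
    rw [hδe]; linarith
  · refine (gm_neg h).trans (ENNReal.ofReal_le_ofReal ?_)
    have h5 : c^2 ≤ 1/2 := by nlinarith
    have h6 := Real.add_one_le_exp (-(c^2/2))
    have h7 : y ≤ 0.8 := by nlinarith
    rw [hδe]; linarith

lemma gm_tail_scaled {τ : ℝ} (hτ : 0 < τ) (t : ℝ) :
    gaussianReal 0 (τ^2).toNNReal (Set.Ioi t) = gaussianReal 0 1 (Set.Ioi (t/τ)) := by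
  have h := gaussianReal_map_const_mul (μ := 0) (v := 1) τ
  have h2 : gaussianReal 0 (τ^2).toNNReal = (gaussianReal 0 1).map (fun x => τ * x) := by
    rw [h]; congr 1
    · simp
    · ext; simp [sq_nonneg]
  rw [h2, Measure.map_apply (by fun_prop) measurableSet_Ioi]
  congr 1
  ext y
  simp [div_lt_iff₀' hτ]

lemma gm_law {k : ℕ} (v : Fin k → ℝ) {σ : ℝ} :
    (Measure.pi fun _ : Fin k => gaussianReal 0 (σ^2).toNNReal).map (fun w => ∑ i, v i * w i)
      = gaussianReal 0 (σ^2 * ∑ i, v i ^ 2).toNNReal := by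
  have h1 : (fun w : Fin k → ℝ => ∑ i, v i * w i)
      = (fun w : Fin k → ℝ => ∑ i, w i) ∘ (fun w i => v i * w i) := rfl
  rw [h1, ← Measure.map_map (by fun_prop) (by fun_prop),
    Measure.pi_map_pi (fun i => by fun_prop)]
  simp_rw [gaussianReal_map_const_mul]
  apply Measure.ext_of_charFun
  ext t
  rw [charFun_map_sum_pi_eq_prod]
  simp only [Finset.prod_apply, charFun_gaussianReal]
  rw [← Complex.exp_sum]
  congr 1
  have h2 : 0 ≤ ∑ i, v i ^ 2 := Finset.sum_nonneg fun i _ => sq_nonneg _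
  rw [Real.coe_toNNReal _ (mul_nonneg (sq_nonneg σ) h2)]
  simp only [NNReal.coe_mul, NNReal.coe_mk, Real.coe_toNNReal _ (sq_nonneg σ)]
  push_cast
  rw [Finset.mul_sum, Finset.sum_mul, Finset.sum_div,
    mul_zero, zero_mul, zero_sub, ← Finset.sum_neg_distrib]
  refine Finset.sum_congr rfl fun i _ => ?_
  ring

lemma gm_density1 (a : ℝ) {σ : ℝ} (hσ : 0 < σ) {s : Set ℝ} (hs : MeasurableSet s) :
    gaussianReal a (σ^2).toNNReal s = ∫⁻ x in s,
      ENNReal.ofReal (Real.exp (a * x / σ^2 - a^2/(2*σ^2))) ∂(gaussianReal 0 (σ^2).toNNReal) := by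
  have hv : (σ^2).toNNReal ≠ 0 := by simp; positivity
  rw [gaussianReal_apply _ hv, gaussianReal_of_var_ne_zero 0 hv,
    setLIntegral_withDensity_eq_setLIntegral_mul _ (measurable_gaussianPDF _ _) (by fun_prop) hs]
  refine setLIntegral_congr_fun hs ?_
  intro x hx
  simp only [Pi.mul_apply, gaussianPDF]
  rw [← ENNReal.ofReal_mul (gaussianPDFReal_nonneg _ _ _)]
  congr 1
  simp only [gaussianPDFReal]
  rw [mul_assoc _ (Real.exp _) (Real.exp _), ← Real.exp_add]
  congr 2
  rw [Real.coe_toNNReal _ (sq_nonneg σ)]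
  field_simp
  ring

lemma gm_density {k : ℕ} (v : Fin k → ℝ) {σ : ℝ} (hσ : 0 < σ) :
    (Measure.pi fun _ : Fin k => gaussianReal 0 (σ^2).toNNReal).map (fun w => v + w)
    = (Measure.pi fun _ : Fin k => gaussianReal 0 (σ^2).toNNReal).withDensity
      (fun w => ENNReal.ofReal (Real.exp (∑ i, (v i * w i / σ^2 - v i^2/(2*σ^2))))) := by
  have h1 : (fun w : Fin k → ℝ => v + w) = (fun w i => v i + w i) := rfl
  rw [h1, Measure.pi_map_pi (fun i => by fun_prop)]
  simp_rw [gaussianReal_map_const_add]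
  apply Measure.pi_eq
  intro s hs
  rw [withDensity_apply _ (MeasurableSet.univ_pi hs)]
  rw [← lintegral_indicator (MeasurableSet.univ_pi hs)]
  have h2 : ∀ w : Fin k → ℝ, (Set.univ.pi s).indicator
      (fun w => ENNReal.ofReal (Real.exp (∑ i, (v i * w i / σ^2 - v i^2/(2*σ^2))))) w
      = ∏ i, (s i).indicator
        (fun x => ENNReal.ofReal (Real.exp (v i * x / σ^2 - v i^2/(2*σ^2)))) (w i) := by
    intro w
    by_cases hw : w ∈ Set.univ.pi s
    · rw [Set.indicator_of_mem hw, Real.exp_sum,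
        ENNReal.ofReal_prod_of_nonneg (fun i _ => (Real.exp_pos _).le)]
      refine Finset.prod_congr rfl fun i _ => ?_
      rw [Set.indicator_of_mem (hw i trivial)]
    · rw [Set.indicator_of_notMem hw]
      simp only [Set.mem_pi, Set.mem_univ, true_implies, not_forall] at hw
      obtain ⟨i, hi⟩ := hw
      exact (Finset.prod_eq_zero (Finset.mem_univ i) (Set.indicator_of_notMem hi _)).symm
  simp_rw [h2]
  have hm : ∀ i, Measurable ((s i).indicator
        (fun x => ENNReal.ofReal (Real.exp (v i * x / σ^2 - v i^2/(2*σ^2))))) :=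
    fun i => Measurable.indicator (by fun_prop) (hs i)
  rw [lintegral_prod_eq_prod_lintegral_of_indepFun Finset.univ
    (fun i (w : Fin k → ℝ) => (s i).indicator
        (fun x => ENNReal.ofReal (Real.exp (v i * x / σ^2 - v i^2/(2*σ^2)))) (w i))
    (iIndepFun_pi (fun i => (hm i).aemeasurable))
    (fun i => (hm i).comp (measurable_pi_apply i))]
  refine Finset.prod_congr rfl fun i _ => ?_
  rw [zero_add, gm_density1 _ hσ (hs i), ← lintegral_indicator (hs i)]
  have := (measurePreserving_eval (fun _ : Fin k => gaussianReal 0 (σ^2).toNNReal) i).map_eq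
  conv_rhs => rw [← this]
  rw [lintegral_map (hm i) (by fun_prop)]

/-- The classical Gaussian mechanism for vector-valued queries in `ℝ^k`
with `ℓ₂`-sensitivity `Δ₂` is `(ε, δ)`-differentially private. -/
theorem gaussian_mechanism_euclidean
    {k : ℕ} (hk : 1 ≤ k)
    {𝒟 : Type*} (adj : 𝒟 → 𝒟 → Prop)
    (f : 𝒟 → EuclideanSpace ℝ (Fin k)) (Δ₂ : ℝ) (hΔ₂ : 0 < Δ₂)
    (ε δ : ℝ) (hε : 0 < ε) (hε1 : ε ≤ 1) (hδ : 0 < δ) (hδ1 : δ < 1)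
    (hsens : ∀ D D', adj D D' → ‖f D - f D'‖ ≤ Δ₂)
    (σ : ℝ) (hσ : σ = Δ₂ * Real.sqrt (2 * Real.log (1.25 / δ)) / ε)
    (ν : Measure (EuclideanSpace ℝ (Fin k)))
    (hν : ν = Measure.map (⇑(EuclideanSpace.equiv (Fin k) ℝ).symm)
        (Measure.pi fun _ : Fin k => gaussianReal 0 (Real.toNNReal (σ ^ 2))))
    (M : 𝒟 → Measure (EuclideanSpace ℝ (Fin k)))
    (hM : ∀ D, M D = Measure.map (fun w => f D + w) ν) :
    ∀ D D', adj D D' → ∀ S : Set (EuclideanSpace ℝ (Fin k)), MeasurableSet S →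
      M D S ≤ ENNReal.ofReal (Real.exp ε) * M D' S + ENNReal.ofReal δ := by
  intro D D' hadj S hS
  have hlog : 0 < Real.log (1.25 / δ) := by
    apply Real.log_pos
    rw [lt_div_iff₀ hδ]; norm_num; linarith
  set c := Real.sqrt (2 * Real.log (1.25 / δ)) with hc
  have hcp : 0 < c := Real.sqrt_pos.2 (by linarith)
  have hσp : 0 < σ := by rw [hσ]; positivity
  set γ := Measure.pi fun _ : Fin k => gaussianReal 0 (Real.toNNReal (σ ^ 2)) with hγ
  let e := (EuclideanSpace.equiv (Fin k) ℝ).symm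
  have hem : Measurable (⇑e) := e.continuous.measurable
  have hMD : ∀ D, M D S = γ {w | f D + e w ∈ S} := by
    intro D
    rw [hM, hν, Measure.map_apply (by fun_prop) hS,
      Measure.map_apply hem ((measurable_const_add (f D)) hS)]
    rfl
  set v : Fin k → ℝ := fun i => (f D - f D') i with hv
  have hev : e v = f D - f D' := rfl
  set T : Set (Fin k → ℝ) := {w | f D' + e w ∈ S} with hT
  have hTm : MeasurableSet T := (hem.const_add (f D')) hS
  set ℓ : (Fin k → ℝ) → ℝ := fun w => ∑ i, (v i * w i / σ^2 - v i^2/(2*σ^2)) with hℓ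
  have hℓm : Measurable ℓ := by fun_prop
  have hdens := gm_density v hσp
  rw [← hγ] at hdens
  have h1 : M D S = γ.map (fun w => v + w) T := by
    rw [hMD, Measure.map_apply (by fun_prop) hTm]
    congr 1
    ext w
    simp only [hT, Set.mem_setOf_eq, Set.mem_preimage, map_add, hev]
    rw [← add_assoc, add_sub_cancel]
  rw [h1, hMD D']
  have hBm : MeasurableSet {w | ε < ℓ w} := measurableSet_lt measurable_const hℓm
  rw [← measure_diff_add_inter T hBm]
  refine add_le_add ?_ ?_
  · rw [hdens, withDensity_apply _ (hTm.diff hBm)]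
    calc _ ≤ ∫⁻ w in T \ {w | ε < ℓ w}, ENNReal.ofReal (Real.exp ε) ∂γ := by
          refine setLIntegral_mono (by fun_prop) ?_
          intro w hw
          have := hw.2
          simp only [Set.mem_setOf_eq, not_lt] at this
          exact ENNReal.ofReal_le_ofReal (Real.exp_le_exp.2 this)
      _ = ENNReal.ofReal (Real.exp ε) * γ (T \ {w | ε < ℓ w}) := by simp
      _ ≤ _ := by gcongr; exact Set.diff_subset
  · refine (measure_mono Set.inter_subset_right).trans ?_
    rw [Measure.map_apply (by fun_prop) hBm]
    set d := ‖f D - f D'‖ with hd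
    have hd2 : ∑ i, v i ^ 2 = d^2 := by
      rw [hd, EuclideanSpace.real_norm_sq_eq]
    have hdΔ : d ≤ Δ₂ := hsens D D' hadj
    have hset : (fun w => v + w) ⁻¹' {w | ε < ℓ w}
        = (fun w => ∑ i, v i * w i) ⁻¹' (Set.Ioi (ε * σ^2 - d^2/2)) := by
      ext w
      have : ℓ (v + w) = (∑ i, v i * w i + d^2/2) / σ^2 := by
        rw [← hd2, hℓ, Finset.sum_div, ← Finset.sum_add_distrib, Finset.sum_div]
        refine Finset.sum_congr rfl fun i _ => ?_
        simp only [Pi.add_apply]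
        field_simp
        ring
      simp only [Set.mem_preimage, Set.mem_setOf_eq, Set.mem_Ioi, this]
      rw [lt_div_iff₀ (by positivity), sub_lt_iff_lt_add]
    rw [hset, ← Measure.map_apply (by fun_prop) measurableSet_Ioi, hγ, gm_law, hd2]
    rcases (norm_nonneg (f D - f D')).eq_or_lt with h0 | h0
    · rw [← hd] at h0
      rw [← h0]
      simp
      have : ¬ (ε * σ^2 < 0) := not_lt.2 (by positivity)
      simp [this]
    · rw [← hd] at h0
      rw [← mul_pow, gm_tail_scaled (by positivity)]
      refine gm_num hε hε1 hδ hδ1 hc ?_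
      have e1 : (ε * σ^2 - d^2/2)/(σ*d) = ε * σ / d - d/(2*σ) := by
        field_simp
      have e2 : c - ε/(2*c) = ε * σ / Δ₂ - Δ₂/(2*σ) := by
        rw [hσ]; field_simp
      rw [e1, e2]
      gcongr
end
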